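/- The shuffle product ⋆ is associative: for f, g, h symmetric Laurent polynomials as above in three pairwise disjoint sets of variables for dimension vectors α•, β•, γ•, one has (f ⋆ g) ⋆ h = f ⋆ (g ⋆ h) as formal power series in the arrow variables t_b whose coefficients are Laurent polynomials in the combined variables for the dimension vector α• + β• + γ•, symmetric at each vertex. -/

import Mathlib

open scoped BigOperators

namespace Shuffle

noncomputable section

/-- The field of rational functions in the variables indexed by `V`: the fraction field of
the multivariate polynomial ring.  Laurent polynomials in the variables `X v` are viewed
inside this field, and the geometric series `(1 - t·x/y)⁻¹` is the honest inverse here. -/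
abbrev FF (V : Type) : Type := FractionRing (MvPolynomial V ℚ)

/-- The variable `X v`, viewed in the rational function field. -/
def xv {V : Type} (v : V) : FF V := algebraMap (MvPolynomial V ℚ) (FF V) (MvPolynomial.X v)

/-- The action of a permutation of the variables on the rational function field,
by renaming variables. -/
def act {V : Type} (σ : Equiv.Perm V) : FF V →+* FF V :=
  IsFractionRing.lift (g := (algebraMap (MvPolynomial V ℚ) (FF V)).comp
      (MvPolynomial.rename σ : MvPolynomial V ℚ →ₐ[ℚ] MvPolynomial V ℚ).toRingHom)
    ((IsFractionRing.injective (MvPolynomial V ℚ) (FF V)).comp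
      (MvPolynomial.rename_injective σ σ.injective))

variable {X Q0 Q1 : Type} [Fintype X] [DecidableEq X] [Fintype Q0] [DecidableEq Q0]
  [Fintype Q1] [DecidableEq Q1]

/-- The `x`-variable indexed by `x : X`, inside the field of rational functions in
the `x`-variables and the arrow variables. -/
def xx (Q1 : Type) (x : X) : FF (X ⊕ Q1) := xv (Sum.inl x)

/-- The arrow variable `t_b`. -/
def tt (X : Type) (b : Q1) : FF (X ⊕ Q1) := xv (Sum.inr b)

/-- Extension of a permutation of the `x`-variables by the identity on the arrow
variables. -/
def permExt (Q1 : Type) (σ : Equiv.Perm X) : Equiv.Perm (X ⊕ Q1) :=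
  Equiv.sumCongr σ (Equiv.refl Q1)

/-- The monomial `x^β` with integer exponents. -/
def xmon (Q1 : Type) (β : X → ℤ) : FF (X ⊕ Q1) := ∏ x : X, (xx Q1 x) ^ (β x)

/-- The staircase exponent for the variables in `S`: each variable `x ∈ S` gets the number
of variables in `S` at the same vertex that come after it (so at each vertex the variables
of `S` receive `ν - 1, ν - 2, …, 1, 0` in their listed order). -/
def rhoS (vert : X → Q0) (lt : X → X → Prop) [DecidableRel lt] (S : Finset X) : X → ℤ :=
  fun x => if x ∈ S then ((S.filter (fun y => vert y = vert x ∧ lt x y)).card : ℤ) else 0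

/-- The antisymmetrizer `J• = Σ (−1)^{w•} w•` over the permutations of the variables in `S`
preserving the vertex of each variable (and fixing all other variables). -/
def Jsym (vert : X → Q0) (S : Finset X) (f : FF (X ⊕ Q1)) : FF (X ⊕ Q1) :=
  ∑ σ ∈ Finset.univ.filter (fun σ : Equiv.Perm X =>
      (∀ x, vert (σ x) = vert x) ∧ ∀ x ∉ S, σ x = x),
    ((Equiv.Perm.sign σ : ℤˣ) : ℤ) • act (permExt Q1 σ) f

/-- The Demazure symmetrizer `D_{w₀•}(f) = J•(x^{ρ•})⁻¹ · J•(x^{ρ•} f)` over the variables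
in `S`, symmetrizing at each vertex. -/
def Dem (vert : X → Q0) (lt : X → X → Prop) [DecidableRel lt] (S : Finset X)
    (f : FF (X ⊕ Q1)) : FF (X ⊕ Q1) :=
  (Jsym vert S (xmon Q1 (rhoS vert lt S)))⁻¹ * Jsym vert S (xmon Q1 (rhoS vert lt S) * f)

/-- The subring of Laurent polynomials over `ℤ[t_b^{±1} : b ∈ Q₁]` in the `x`-variables
belonging to `S`. -/
def LaurentIn (Q1 : Type) [Fintype Q1] (S : Finset X) : Subring (FF (X ⊕ Q1)) :=
  Subring.closure
    ((fun x : X => xx Q1 x) '' ↑S ∪ (fun x : X => (xx Q1 x)⁻¹) '' ↑S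
      ∪ Set.range (tt X (Q1 := Q1)) ∪ Set.range (fun b : Q1 => (tt X b)⁻¹))

/-- `f` is symmetric in the variables of `S` at each vertex. -/
def SymmOn (Q1 : Type) (vert : X → Q0) (S : Finset X) (f : FF (X ⊕ Q1)) : Prop :=
  ∀ σ : Equiv.Perm X, (∀ x, vert (σ x) = vert x) → (∀ x ∉ S, σ x = x) →
    act (permExt Q1 σ) f = f

/-- The shuffle product `f * g` of `f` (in the variables of `A`) and `g` (in the variables
of `B`): `D_{w₀•}(f · g · ∏_b ∏_{y ∈ B, vert y = tb} ∏_{x ∈ A, vert x = hb}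
(1 − t_b y/x))`. -/
def starMul (vert : X → Q0) (hd tl : Q1 → Q0) (lt : X → X → Prop) [DecidableRel lt]
    (A B : Finset X) (f g : FF (X ⊕ Q1)) : FF (X ⊕ Q1) :=
  Dem vert lt (A ∪ B) (f * g *
    ∏ b : Q1, ∏ y ∈ B.filter (fun y => vert y = tl b), ∏ x ∈ A.filter (fun x => vert x = hd b),
      (1 - tt X b * xx Q1 y / xx Q1 x))

/-- The shuffle product `f ⋆ g` of `f` (in the variables of `A`) and `g` (in the variables
of `B`): `D_{w₀•}(f · g · ∏_b ∏_{x ∈ A, vert x = tb} ∏_{y ∈ B, vert y = hb}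
(1 − t_b x/y)⁻¹)`. -/
def starGeom (vert : X → Q0) (hd tl : Q1 → Q0) (lt : X → X → Prop) [DecidableRel lt]
    (A B : Finset X) (f g : FF (X ⊕ Q1)) : FF (X ⊕ Q1) :=
  Dem vert lt (A ∪ B) (f * g *
    ∏ b : Q1, ∏ x ∈ A.filter (fun x => vert x = tl b), ∏ y ∈ B.filter (fun y => vert y = hd b),
      (1 - tt X b * xx Q1 x / xx Q1 y)⁻¹)

end

end Shuffle

namespace Shuffle

section Action

variable {V : Type}

lemma act_xv (σ : Equiv.Perm V) (v : V) : act σ (xv v) = xv (σ v) := by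
  simp [act, xv]

lemma act_act (σ τ : Equiv.Perm V) (f : FF V) : act σ (act τ f) = act (σ * τ) f := by
  suffices h : (act σ).comp (act τ) = act (σ * τ) from congrArg (fun φ => φ f) h
  refine IsLocalization.ringHom_ext (nonZeroDivisors (MvPolynomial V ℚ)) ?_
  refine MvPolynomial.ringHom_ext (fun r => ?_) (fun v => ?_)
  · simp [act]
  · change act σ (act τ (xv v)) = act (σ * τ) (xv v)
    simp [act_xv]

lemma act_one (f : FF V) : act 1 f = f := by
  suffices h : act (1 : Equiv.Perm V) = RingHom.id _ from congrArg (fun φ => φ f) h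
  refine IsLocalization.ringHom_ext (nonZeroDivisors (MvPolynomial V ℚ)) ?_
  refine MvPolynomial.ringHom_ext (fun r => ?_) (fun v => ?_)
  · simp [act]
  · change act 1 (xv v) = xv v
    simp [act_xv]

end Action

variable {X Q0 Q1 : Type}

lemma act_permExt_xx (σ : Equiv.Perm X) (x : X) :
    act (permExt Q1 σ) (xx Q1 x) = xx Q1 (σ x) := by
  simp [xx, act_xv, permExt]

lemma act_permExt_tt (σ : Equiv.Perm X) (b : Q1) :
    act (permExt Q1 σ) (tt X b) = tt X b := by
  simp [tt, act_xv, permExt]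

lemma act_permExt_act (σ τ : Equiv.Perm X) (f : FF (X ⊕ Q1)) :
    act (permExt Q1 σ) (act (permExt Q1 τ) f) = act (permExt Q1 (σ * τ)) f := by
  rw [act_act]
  congr 2
  ext v
  cases v <;> rfl

lemma act_permExt_one (f : FF (X ⊕ Q1)) : act (permExt Q1 1) f = f := by
  have h : permExt Q1 (1 : Equiv.Perm X) = 1 := by
    ext v
    cases v <;> rfl
  rw [h, act_one]

/-- The permutations of the variables in `S` that preserve vertices. -/
def vertPerm (vert : X → Q0) (S : Finset X) : Subgroup (Equiv.Perm X) where
  carrier := {σ | (∀ x, vert (σ x) = vert x) ∧ ∀ x ∉ S, σ x = x}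
  mul_mem' := by
    rintro σ τ ⟨h₁, h₂⟩ ⟨k₁, k₂⟩
    refine ⟨fun x => by simp [h₁, k₁], fun x hx => by simp [h₂ x hx, k₂ x hx]⟩
  one_mem' := by simp
  inv_mem' := by
    rintro σ ⟨h₁, h₂⟩
    refine ⟨fun x => ?_, fun x hx => ?_⟩
    · rw [← h₁, ← Equiv.Perm.mul_apply, mul_inv_cancel, Equiv.Perm.one_apply]
    · rw [Equiv.Perm.inv_eq_iff_eq, h₂ x hx]

lemma mem_vertPerm {vert : X → Q0} {S : Finset X} {σ : Equiv.Perm X} :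
    σ ∈ vertPerm vert S ↔ (∀ x, vert (σ x) = vert x) ∧ ∀ x ∉ S, σ x = x := Iff.rfl

lemma vertPerm_mono (vert : X → Q0) {T S : Finset X} (h : T ⊆ S) :
    vertPerm vert T ≤ vertPerm vert S :=
  fun _ hσ => ⟨hσ.1, fun x hx => hσ.2 x fun hT => hx (h hT)⟩

lemma apply_mem_iff_of_mem_vertPerm {vert : X → Q0} {S : Finset X} {σ : Equiv.Perm X}
    (hσ : σ ∈ vertPerm vert S) (x : X) : σ x ∈ S ↔ x ∈ S := by
  constructor
  · intro h
    by_contra hx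
    exact hx (hσ.2 x hx ▸ h)
  · intro h
    by_contra hx
    have := σ.injective (hσ.2 _ hx)
    exact hx (this.symm ▸ h)

lemma apply_eq_of_mem_vertPerm_of_disjoint {vert : X → Q0} {S D : Finset X} {σ : Equiv.Perm X}
    (hσ : σ ∈ vertPerm vert S) (hD : Disjoint S D) {x : X} (hx : x ∈ D) : σ x = x :=
  hσ.2 x fun h => Finset.disjoint_left.1 hD h hx

lemma apply_mem_iff_of_mem_vertPerm_of_disjoint {vert : X → Q0} {S D : Finset X}
    {σ : Equiv.Perm X} (hσ : σ ∈ vertPerm vert S) (hD : Disjoint S D) (x : X) :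
    σ x ∈ D ↔ x ∈ D := by
  constructor
  · intro h
    have := σ.injective (apply_eq_of_mem_vertPerm_of_disjoint hσ hD h)
    exact this ▸ h
  · intro h
    rwa [apply_eq_of_mem_vertPerm_of_disjoint hσ hD h]

lemma xx_ne_zero (x : X) : xx Q1 x ≠ 0 := by
  unfold xx xv
  rw [Ne, FaithfulSMul.algebraMap_eq_zero_iff]
  exact MvPolynomial.X_ne_zero _

lemma act_eq_of_mem_LaurentIn [Fintype Q1] {vert : X → Q0} {S D : Finset X} (hD : Disjoint S D)
    {σ : Equiv.Perm X} (hσ : σ ∈ vertPerm vert S) {f : FF (X ⊕ Q1)} (hf : f ∈ LaurentIn Q1 D) :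
    act (permExt Q1 σ) f = f := by
  suffices h : LaurentIn Q1 D ≤ (act (permExt Q1 σ)).eqLocus (RingHom.id _) from h hf
  refine Subring.closure_le.2 ?_
  rintro _ (((⟨x, hx, rfl⟩ | ⟨x, hx, rfl⟩) | ⟨b, rfl⟩) | ⟨b, rfl⟩) <;>
    simp [RingHom.mem_eqLocus, act_permExt_xx, act_permExt_tt]
  all_goals rw [apply_eq_of_mem_vertPerm_of_disjoint hσ hD hx]

section Kernel

variable [DecidableEq Q0] [Fintype Q1] (vert : X → Q0) (hd tl : Q1 → Q0)

/-- The product of the factors `(1 - t_b x / y)⁻¹` in the shuffle product. -/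
noncomputable def kern (A B : Finset X) : FF (X ⊕ Q1) :=
  ∏ b : Q1, ∏ x ∈ A.filter (fun x => vert x = tl b), ∏ y ∈ B.filter (fun y => vert y = hd b),
    (1 - tt X b * xx Q1 x / xx Q1 y)⁻¹

lemma act_kern {A B : Finset X} {σ : Equiv.Perm X} (hv : ∀ x, vert (σ x) = vert x)
    (hA : ∀ x, σ x ∈ A ↔ x ∈ A) (hB : ∀ x, σ x ∈ B ↔ x ∈ B) :
    act (permExt Q1 σ) (kern vert hd tl A B) = kern vert hd tl A B := by
  simp only [kern, map_prod, map_inv₀, map_sub, map_one, map_div₀, map_mul, act_permExt_xx,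
    act_permExt_tt]
  refine Finset.prod_congr rfl fun b _ => Finset.prod_equiv σ (by simp [hv, hA]) fun x _ => ?_
  exact Finset.prod_equiv σ (by simp [hv, hB]) fun y _ => rfl

lemma kern_union_left [DecidableEq X] {A B : Finset X} (h : Disjoint A B) (C : Finset X) :
    kern vert hd tl (A ∪ B) C = kern vert hd tl A C * kern vert hd tl B C := by
  simp only [kern, ← Finset.prod_mul_distrib, Finset.filter_union]
  exact Finset.prod_congr rfl fun b _ =>
    Finset.prod_union (Finset.disjoint_filter_filter h)

lemma kern_union_right [DecidableEq X] (A : Finset X) {B C : Finset X} (h : Disjoint B C) :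
    kern vert hd tl A (B ∪ C) = kern vert hd tl A B * kern vert hd tl A C := by
  simp only [kern, ← Finset.prod_mul_distrib, Finset.filter_union]
  exact Finset.prod_congr rfl fun b _ => Finset.prod_congr rfl fun x _ =>
    Finset.prod_union (Finset.disjoint_filter_filter h)

end Kernel

section Monomial

variable [Fintype X]

lemma xmon_add (β γ : X → ℤ) : xmon Q1 (β + γ) = xmon Q1 β * xmon Q1 γ := by
  simp only [xmon, ← Finset.prod_mul_distrib, Pi.add_apply]
  exact Finset.prod_congr rfl fun x _ => zpow_add₀ (xx_ne_zero x) _ _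

lemma act_xmon (σ : Equiv.Perm X) (β : X → ℤ) :
    act (permExt Q1 σ) (xmon Q1 β) = xmon Q1 (fun x => β (σ⁻¹ x)) := by
  simp only [xmon, map_prod, map_zpow₀, act_permExt_xx]
  exact Fintype.prod_equiv σ _ _ fun x => by simp

/-- The exponent vector of a monomial in the `x`-variables only. -/
noncomputable def xexp (Q1 : Type) (n : X → ℕ) : X ⊕ Q1 →₀ ℕ :=
  ∑ x, Finsupp.single (Sum.inl x) (n x)

lemma xexp_inl (n : X → ℕ) (x : X) : xexp Q1 n (Sum.inl x) = n x := by
  classical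
  simp [xexp, Finsupp.finsetSum_apply, Finsupp.single_apply]

lemma xmon_natCast (n : X → ℕ) :
    xmon Q1 (fun x => (n x : ℤ)) =
      algebraMap (MvPolynomial (X ⊕ Q1) ℚ) (FF (X ⊕ Q1)) (MvPolynomial.monomial (xexp Q1 n) 1) := by
  simp only [xmon, xexp, MvPolynomial.monomial_sum_one, map_prod, zpow_natCast]
  refine Finset.prod_congr rfl fun x _ => ?_
  rw [← MvPolynomial.X_pow_eq_monomial, map_pow]
  rfl

end Monomial

section Staircase

variable [DecidableEq X] [DecidableEq Q0] (vert : X → Q0) (lt : X → X → Prop) [DecidableRel lt]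

lemma rhoS_lt_rhoS [IsStrictOrder X lt] {S : Finset X} {x y : X} (hx : x ∈ S) (hy : y ∈ S)
    (hxy : vert x = vert y) (h : lt x y) : rhoS vert lt S y < rhoS vert lt S x := by
  simp only [rhoS, if_pos hx, if_pos hy, Nat.cast_lt]
  refine Finset.card_lt_card ⟨fun z hz => ?_, fun hss => ?_⟩
  · simp only [Finset.mem_filter] at hz ⊢
    exact ⟨hz.1, hz.2.1.trans hxy.symm, _root_.trans h hz.2.2⟩
  · have := hss (Finset.mem_filter.2 ⟨hy, hxy.symm, h⟩)
    exact irrefl y (Finset.mem_filter.1 this).2.2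

lemma rhoS_sub_rhoS_apply {T S : Finset X} (hTS : T ⊆ S)
    (hlt : ∀ y ∈ S \ T, ∀ x ∈ T, ∀ x' ∈ T, lt x y → lt x' y) {σ : Equiv.Perm X}
    (hσ : σ ∈ vertPerm vert T) (x : X) :
    rhoS vert lt S (σ x) - rhoS vert lt T (σ x) = rhoS vert lt S x - rhoS vert lt T x := by
  by_cases hx : x ∈ T
  · have hsub : ∀ z ∈ T, rhoS vert lt S z - rhoS vert lt T z =
        (((S \ T).filter (fun y => vert y = vert z ∧ lt z y)).card : ℤ) := by
      intro z hz
      rw [rhoS, rhoS, if_pos hz, if_pos (hTS hz), ← Finset.sdiff_union_of_subset hTS,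
        Finset.filter_union, Finset.card_union_of_disjoint
          (Finset.disjoint_filter_filter Finset.sdiff_disjoint), Finset.sdiff_union_of_subset hTS]
      push_cast
      ring
    have hσx := (apply_mem_iff_of_mem_vertPerm hσ x).2 hx
    rw [hsub x hx, hsub _ hσx, hσ.1 x]
    congr 2
    refine Finset.filter_congr fun y hy => and_congr_right fun _ => ?_
    exact ⟨hlt y hy _ hσx _ hx, hlt y hy _ hx _ hσx⟩
  · rw [hσ.2 x hx]

end Staircase

variable [Fintype X] [DecidableEq X] [DecidableEq Q0]

open Classical in
lemma Jsym_eq_sum (vert : X → Q0) (S : Finset X) (f : FF (X ⊕ Q1)) :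
    Jsym vert S f = ∑ σ : vertPerm vert S,
      ((Equiv.Perm.sign (σ : Equiv.Perm X) : ℤˣ) : ℤ) • act (permExt Q1 (σ : Equiv.Perm X)) f := by
  unfold Jsym
  refine Finset.sum_subtype _ (fun σ => ?_)
    (fun σ : Equiv.Perm X => ((Equiv.Perm.sign σ : ℤˣ) : ℤ) • act (permExt Q1 σ) f)
  simp [mem_vertPerm]

lemma sign_smul_sign_smul (σ : Equiv.Perm X) (f : FF (X ⊕ Q1)) :
    ((Equiv.Perm.sign σ : ℤˣ) : ℤ) • ((Equiv.Perm.sign σ : ℤˣ) : ℤ) • f = f := by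
  rw [smul_smul, ← Units.val_mul, Int.units_mul_self, Units.val_one, one_smul]

lemma Jsym_act (vert : X → Q0) {S : Finset X} {τ : Equiv.Perm X} (hτ : τ ∈ vertPerm vert S)
    (f : FF (X ⊕ Q1)) :
    Jsym vert S (act (permExt Q1 τ) f) = ((Equiv.Perm.sign τ : ℤˣ) : ℤ) • Jsym vert S f := by
  classical
  simp only [Jsym_eq_sum, Finset.smul_sum]
  refine Fintype.sum_equiv (Equiv.mulRight (⟨τ, hτ⟩ : vertPerm vert S)) _ _ fun σ => ?_
  simp only [Equiv.coe_mulRight, Subgroup.coe_mul, act_permExt_act, Equiv.Perm.sign_mul]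
  rw [mul_comm, Units.val_mul, mul_smul, sign_smul_sign_smul]

lemma act_Jsym (vert : X → Q0) {S : Finset X} {τ : Equiv.Perm X} (hτ : τ ∈ vertPerm vert S)
    (f : FF (X ⊕ Q1)) :
    act (permExt Q1 τ) (Jsym vert S f) = ((Equiv.Perm.sign τ : ℤˣ) : ℤ) • Jsym vert S f := by
  classical
  simp only [Jsym_eq_sum, Finset.smul_sum, map_sum, map_zsmul]
  refine Fintype.sum_equiv (Equiv.mulLeft (⟨τ, hτ⟩ : vertPerm vert S)) _ _ fun σ => ?_
  simp only [Equiv.coe_mulLeft, Subgroup.coe_mul, act_permExt_act, Equiv.Perm.sign_mul]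
  rw [Units.val_mul, mul_smul, sign_smul_sign_smul]

lemma Jsym_mul_of_invariant (vert : X → Q0) {S : Finset X} {u : FF (X ⊕ Q1)}
    (hu : ∀ σ ∈ vertPerm vert S, act (permExt Q1 σ) u = u) (f : FF (X ⊕ Q1)) :
    Jsym vert S (u * f) = u * Jsym vert S f := by
  classical
  simp only [Jsym_eq_sum, Finset.mul_sum]
  refine Finset.sum_congr rfl fun σ _ => ?_
  rw [map_mul, hu σ σ.2, mul_smul_comm]

lemma Jsym_sum (vert : X → Q0) (S : Finset X) {ι : Type*} (s : Finset ι)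
    (F : ι → FF (X ⊕ Q1)) : Jsym vert S (∑ i ∈ s, F i) = ∑ i ∈ s, Jsym vert S (F i) := by
  simp only [Jsym, map_sum, Finset.smul_sum]
  exact Finset.sum_comm

lemma Jsym_zsmul (vert : X → Q0) (S : Finset X) (n : ℤ) (f : FF (X ⊕ Q1)) :
    Jsym vert S (n • f) = n • Jsym vert S f := by
  simp only [Jsym, map_zsmul, Finset.smul_sum]
  exact Finset.sum_congr rfl fun σ _ => smul_comm _ _ _

open Classical in
lemma Jsym_mul_Jsym (vert : X → Q0) {T S : Finset X} (hTS : T ⊆ S) (u f : FF (X ⊕ Q1)) :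
    Jsym vert S (u * Jsym vert T f) =
      Jsym vert S ((∑ τ : vertPerm vert T, act (permExt Q1 (τ : Equiv.Perm X)) u) * f) := by
  rw [Jsym_eq_sum vert T, Finset.mul_sum, Finset.sum_mul, Jsym_sum, Jsym_sum]
  refine Fintype.sum_equiv (Equiv.inv _) _ _ fun τ => ?_
  have h : u * act (permExt Q1 (τ : Equiv.Perm X)) f =
      act (permExt Q1 (τ : Equiv.Perm X)) (act (permExt Q1 (τ : Equiv.Perm X)⁻¹) u * f) := by
    rw [map_mul, act_permExt_act, mul_inv_cancel, act_permExt_one]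
  rw [mul_smul_comm, Jsym_zsmul, h, Jsym_act vert (vertPerm_mono vert hTS τ.2),
    sign_smul_sign_smul]
  simp

lemma Jsym_xmon_natCast_ne_zero (vert : X → Q0) (T : Finset X) (n : X → ℕ)
    (hn : ∀ x ∈ T, ∀ y ∈ T, vert x = vert y → n x = n y → x = y) :
    Jsym vert T (xmon Q1 (fun x => (n x : ℤ))) ≠ 0 := by
  classical
  have key : Jsym vert T (xmon Q1 (fun x => (n x : ℤ))) =
      algebraMap (MvPolynomial (X ⊕ Q1) ℚ) (FF (X ⊕ Q1))
        (∑ σ : vertPerm vert T, ((Equiv.Perm.sign (σ : Equiv.Perm X) : ℤˣ) : ℤ) •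
          MvPolynomial.monomial (xexp Q1 (fun x => n ((σ : Equiv.Perm X)⁻¹ x))) 1) := by
    rw [Jsym_eq_sum, map_sum]
    refine Finset.sum_congr rfl fun σ _ => ?_
    rw [map_zsmul, act_xmon, ← xmon_natCast]
  rw [key, Ne, FaithfulSMul.algebraMap_eq_zero_iff]
  intro h0
  have h1 := congrArg (MvPolynomial.coeff (xexp Q1 n)) h0
  rw [MvPolynomial.coeff_sum, MvPolynomial.coeff_zero, Finset.sum_eq_single 1] at h1
  · simp at h1
  · intro σ _ hσ
    rw [MvPolynomial.coeff_smul, MvPolynomial.coeff_monomial, if_neg, smul_zero]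
    intro he
    apply hσ
    rw [← inv_eq_one]
    ext x
    have hσ' := (σ⁻¹).2
    by_cases hx : x ∈ T
    · refine hn _ ((apply_mem_iff_of_mem_vertPerm hσ' x).2 hx) _ hx (hσ'.1 x) ?_
      simpa [xexp_inl] using DFunLike.congr_fun he (Sum.inl x)
    · exact hσ'.2 x hx
  · simp

section Order

variable (vert : X → Q0) (lt : X → X → Prop) [DecidableRel lt]

lemma Jsym_xmon_rhoS_ne_zero [IsStrictTotalOrder X lt] (S : Finset X) :
    Jsym vert S (xmon Q1 (rhoS vert lt S)) ≠ 0 := by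
  have hcast : rhoS vert lt S = fun x => ((rhoS vert lt S x).toNat : ℤ) := by
    funext x
    refine (Int.toNat_of_nonneg ?_).symm
    unfold rhoS
    split_ifs <;> positivity
  rw [hcast]
  refine Jsym_xmon_natCast_ne_zero vert S _ fun x hx y hy hxy hn => ?_
  have hn' : rhoS vert lt S x = rhoS vert lt S y := by
    rw [congrFun hcast x, congrFun hcast y, hn]
  rcases trichotomous_of lt x y with h | h | h
  · exact absurd hn' (rhoS_lt_rhoS vert lt hx hy hxy h).ne'
  · exact h
  · exact absurd hn' (rhoS_lt_rhoS vert lt hy hx hxy.symm h).ne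

/-- Demazure symmetrization over a block `T` of consecutive variables of `S` is absorbed by
symmetrization over `S`. -/
lemma Dem_Dem [IsStrictTotalOrder X lt] {T S : Finset X} (hTS : T ⊆ S)
    (hlt : ∀ y ∈ S \ T, ∀ x ∈ T, ∀ x' ∈ T, lt x y → lt x' y) (f : FF (X ⊕ Q1)) :
    Dem vert lt S (Dem vert lt T f) = Dem vert lt S f := by
  classical
  unfold Dem
  congr 1
  set a := xmon Q1 (rhoS vert lt T) with ha
  set m := xmon Q1 (rhoS vert lt S - rhoS vert lt T) with hm
  have hS : xmon Q1 (rhoS vert lt S) = m * a := by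
    rw [ha, hm, ← xmon_add, sub_add_cancel]
  have hmi : ∀ σ ∈ vertPerm vert T, act (permExt Q1 σ) m = m := by
    intro σ hσ
    rw [hm, act_xmon]
    congr 1
    funext x
    exact rhoS_sub_rhoS_apply vert lt hTS hlt (inv_mem hσ) x
  have hΔ : Jsym vert T a ≠ 0 := Jsym_xmon_rhoS_ne_zero vert lt T
  have hsum : ∑ τ : vertPerm vert T,
      act (permExt Q1 (τ : Equiv.Perm X)) (m * a * (Jsym vert T a)⁻¹) = m := by
    calc _ = ∑ τ : vertPerm vert T, m * (Jsym vert T a)⁻¹ *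
          (((Equiv.Perm.sign (τ : Equiv.Perm X) : ℤˣ) : ℤ) •
            act (permExt Q1 (τ : Equiv.Perm X)) a) := by
          refine Finset.sum_congr rfl fun τ _ => ?_
          rw [map_mul, map_mul, map_inv₀, hmi τ τ.2, act_Jsym vert τ.2]
          rcases Int.units_eq_one_or (Equiv.Perm.sign (τ : Equiv.Perm X)) with h | h <;>
            simp only [h, Units.val_one, Units.val_neg, one_smul, neg_smul, inv_neg] <;> ring
      _ = m * (Jsym vert T a)⁻¹ * Jsym vert T a := by rw [← Finset.mul_sum, ← Jsym_eq_sum]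
      _ = m := by rw [mul_assoc, inv_mul_cancel₀ hΔ, mul_one]
  rw [hS, ← mul_assoc, Jsym_mul_Jsym vert hTS, hsum, mul_assoc]

lemma Dem_mul_of_invariant {S : Finset X} {u : FF (X ⊕ Q1)}
    (hu : ∀ σ ∈ vertPerm vert S, act (permExt Q1 σ) u = u) (f : FF (X ⊕ Q1)) :
    Dem vert lt S (u * f) = u * Dem vert lt S f := by
  rw [Dem, Dem, mul_left_comm, Jsym_mul_of_invariant vert hu, mul_left_comm]

end Order

section Assoc

variable [Fintype Q1] (vert : X → Q0) (hd tl : Q1 → Q0)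

lemma starGeom_eq (lt : X → X → Prop) [DecidableRel lt] (A B : Finset X) (f g : FF (X ⊕ Q1)) :
    starGeom vert hd tl lt A B f g = Dem vert lt (A ∪ B) (f * g * kern vert hd tl A B) := rfl

lemma starGeom_assoc (lt : X → X → Prop) [DecidableRel lt] [IsStrictTotalOrder X lt]
    {A B C : Finset X} (hAB : Disjoint A B) (hAC : Disjoint A C) (hBC : Disjoint B C)
    (hACo : ∀ x ∈ A, ∀ z ∈ C, lt x z) (hBCo : ∀ y ∈ B, ∀ z ∈ C, lt y z)
    (hABo : ∀ x ∈ A, ∀ y ∈ B, lt x y) {f h : FF (X ⊕ Q1)} (g : FF (X ⊕ Q1))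
    (hf : f ∈ LaurentIn Q1 A) (hh : h ∈ LaurentIn Q1 C) :
    starGeom vert hd tl lt (A ∪ B) C (starGeom vert hd tl lt A B f g) h
      = starGeom vert hd tl lt A (B ∪ C) f (starGeom vert hd tl lt B C g h) := by
  have hABC : Disjoint (A ∪ B) C := Finset.disjoint_union_left.2 ⟨hAC, hBC⟩
  have hBCA : Disjoint (B ∪ C) A := Finset.disjoint_union_left.2 ⟨hAB.symm, hAC.symm⟩
  have hl : ∀ σ ∈ vertPerm vert (A ∪ B),
      act (permExt Q1 σ) (h * kern vert hd tl (A ∪ B) C) = h * kern vert hd tl (A ∪ B) C := by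
    intro σ hσ
    rw [map_mul, act_eq_of_mem_LaurentIn hABC hσ hh, act_kern vert hd tl hσ.1
      (apply_mem_iff_of_mem_vertPerm hσ) (apply_mem_iff_of_mem_vertPerm_of_disjoint hσ hABC)]
  have hr : ∀ σ ∈ vertPerm vert (B ∪ C),
      act (permExt Q1 σ) (f * kern vert hd tl A (B ∪ C)) = f * kern vert hd tl A (B ∪ C) := by
    intro σ hσ
    rw [map_mul, act_eq_of_mem_LaurentIn hBCA hσ hf, act_kern vert hd tl hσ.1
      (apply_mem_iff_of_mem_vertPerm_of_disjoint hσ hBCA) (apply_mem_iff_of_mem_vertPerm hσ)]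
  simp only [starGeom_eq]
  rw [mul_assoc (Dem _ _ _ _) h, mul_comm (Dem _ _ _ _), ← Dem_mul_of_invariant vert lt hl,
    mul_right_comm f (Dem _ _ _ _), ← Dem_mul_of_invariant vert lt hr,
    Dem_Dem vert lt Finset.subset_union_left, Dem_Dem vert lt Finset.subset_union_right,
    Finset.union_assoc, kern_union_left vert hd tl hAB, kern_union_right vert hd tl A hBC]
  · congr 1
    ring
  · intro y hy x hx x' hx' hxy
    have hyA : y ∈ A := by
      simp only [Finset.mem_sdiff, Finset.mem_union] at hy
      tauto
    have hyx : lt y x := (Finset.mem_union.1 hx).elim (hABo y hyA x) (hACo y hyA x)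
    exact absurd hxy (asymm hyx)
  · intro y hy x hx x' hx' _
    have hyC : y ∈ C := by
      simp only [Finset.mem_sdiff, Finset.mem_union] at hy
      tauto
    exact (Finset.mem_union.1 hx').elim (fun h' => hACo x' h' y hyC) (fun h' => hBCo x' h' y hyC)

end Assoc

end Shuffle

open Shuffle in
/-- the shuffle product `⋆` is associative: `(f ⋆ g) ⋆ h = f ⋆ (g ⋆ h)`. -/
theorem stmt_11
    (Q0 Q1 X : Type) [Fintype Q0] [DecidableEq Q0] [Fintype Q1] [DecidableEq Q1]
    [Fintype X] [DecidableEq X] [LinearOrder X]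
    (hd tl : Q1 → Q0)
    (vert : X → Q0)
    (A B C : Finset X)
    (hAB : Disjoint A B) (hAC : Disjoint A C) (hBC : Disjoint B C)
    -- the variables are listed in the order: those of `A`, then `B`, then `C`
    (hABo : ∀ x ∈ A, ∀ y ∈ B, x < y)
    (hACo : ∀ x ∈ A, ∀ z ∈ C, x < z)
    (hBCo : ∀ y ∈ B, ∀ z ∈ C, y < z)
    (f g h : FF (X ⊕ Q1))
    (hfL : f ∈ LaurentIn Q1 A) (hfS : SymmOn Q1 vert A f)
    (hgL : g ∈ LaurentIn Q1 B) (hgS : SymmOn Q1 vert B g)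
    (hhL : h ∈ LaurentIn Q1 C) (hhS : SymmOn Q1 vert C h) :
    starGeom vert hd tl (· < ·) (A ∪ B) C (starGeom vert hd tl (· < ·) A B f g) h
      = starGeom vert hd tl (· < ·) A (B ∪ C) f (starGeom vert hd tl (· < ·) B C g h) := by
  exact starGeom_assoc vert hd tl (· < ·) hAB hAC hBC hACo hBCo hABo g hfL hhL
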